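/- Let {A_n} be a sequence of arrangements of d_n lines with d_n → ∞ such that each A_n is neither trivial nor quasi-trivial (t_{d_n} = t_{d_n−1} = 0). Then c̄₂(A_n) → ∞. -/

import Mathlib

open scoped BigOperators

/-- Points and lines of the projective plane over `k` (lines via duality). -/
abbrev ProjPlane (k : Type*) [Field k] := Projectivization k (Fin 3 → k)

/-- Incidence between a point `p` and a line `L` (given by its dual coefficients):
all representatives pair to zero under the standard bilinear form. -/
def Incid {k : Type*} [Field k] (p L : ProjPlane k) : Prop :=
  ∀ v ∈ p.submodule, ∀ w ∈ L.submodule, ∑ i, v i * w i = 0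

/-- Number of lines of the arrangement `A` passing through the point `p`. -/
noncomputable def linesThrough {k : Type*} [Field k]
    (A : Finset (ProjPlane k)) (p : ProjPlane k) : ℕ :=
  {L : ProjPlane k | L ∈ A ∧ Incid p L}.ncard

/-- `tm A m` is the number of `m`-points of the arrangement `A`. -/
noncomputable def tm {k : Type*} [Field k]
    (A : Finset (ProjPlane k)) (m : ℕ) : ℕ :=
  {p : ProjPlane k | linesThrough A p = m}.ncard

/-- The arrangement is trivial if all its lines pass through a common point. -/
def IsTrivial {k : Type*} [Field k] (A : Finset (ProjPlane k)) : Prop :=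
  ∃ p : ProjPlane k, ∀ L ∈ A, Incid p L

/-- First Chern number of a line arrangement. -/
noncomputable def c1sq {k : Type*} [Field k] (A : Finset (ProjPlane k)) : ℤ :=
  9 - 5 * (A.card : ℤ) +
    ∑ m ∈ Finset.Icc 2 A.card, (3 * (m : ℤ) - 4) * (tm A m : ℤ)

/-- Second Chern number of a line arrangement. -/
noncomputable def c2 {k : Type*} [Field k] (A : Finset (ProjPlane k)) : ℤ :=
  3 - 2 * (A.card : ℤ) +
    ∑ m ∈ Finset.Icc 2 A.card, ((m : ℤ) - 1) * (tm A m : ℤ)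

open Projectivization Configuration in
theorem incid_iff_orthogonal {k : Type*} [Field k] (p L : ProjPlane k) :
    Incid p L ↔ orthogonal p L := by
  induction p using Projectivization.ind with | h v hv =>
  induction L using Projectivization.ind with | h w hw =>
  rw [orthogonal_mk]
  simp only [Incid, submodule_mk, Submodule.mem_span_singleton]
  refine ⟨fun h ↦ h v ⟨1, one_smul _ _⟩ w ⟨1, one_smul _ _⟩, ?_⟩
  rintro h _ ⟨a, rfl⟩ _ ⟨b, rfl⟩
  change (a • v) ⬝ᵥ (b • w) = 0
  simp [h]

theorem Incid.eq_or_eq {k : Type*} [Field k] {p q L M : ProjPlane k} (hpL : Incid p L)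
    (hqL : Incid q L) (hpM : Incid p M) (hqM : Incid q M) : p = q ∨ L = M := by
  rw [incid_iff_orthogonal] at *
  exact Configuration.ofField.eq_or_eq_of_orthogonal hpL hqL hpM hqM

section Counting

open Finset
open scoped Classical

variable {k : Type*} [Field k] (A : Finset (ProjPlane k))

theorem incid_cross {L M : ProjPlane k} (h : L ≠ M) :
    Incid (Projectivization.cross L M) L ∧ Incid (Projectivization.cross L M) M := by
  simp only [incid_iff_orthogonal]
  exact ⟨Projectivization.cross_orthogonal_left h, Projectivization.cross_orthogonal_right h⟩

theorem cross_eq_iff_incid {p L M : ProjPlane k} (h : L ≠ M) :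
    Projectivization.cross L M = p ↔ Incid p L ∧ Incid p M := by
  obtain ⟨hL, hM⟩ := incid_cross h
  refine ⟨fun hp ↦ hp ▸ ⟨hL, hM⟩, fun hp ↦ ?_⟩
  exact (hL.eq_or_eq hp.1 hM hp.2).resolve_right h

theorem linesThrough_eq_card (p : ProjPlane k) :
    linesThrough A p = #{L ∈ A | Incid p L} := by
  rw [linesThrough, ← Set.ncard_coe_finset]
  simp

theorem linesThrough_le_card (p : ProjPlane k) : linesThrough A p ≤ #A :=
  linesThrough_eq_card A p ▸ card_filter_le _ _

/-- The points lying on at least two lines of the arrangement. -/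
noncomputable def multiplePoints : Finset (ProjPlane k) :=
  A.offDiag.image fun x ↦ Projectivization.cross x.1 x.2

theorem mem_multiplePoints {p : ProjPlane k} :
    p ∈ multiplePoints A ↔ 2 ≤ linesThrough A p := by
  rw [linesThrough_eq_card, Nat.succ_le_iff, one_lt_card]
  simp only [multiplePoints, mem_image, mem_offDiag, Prod.exists, mem_filter]
  constructor
  · rintro ⟨L, M, ⟨hL, hM, h⟩, hp⟩
    have := (cross_eq_iff_incid h).1 hp
    exact ⟨L, ⟨hL, this.1⟩, M, ⟨hM, this.2⟩, h⟩
  · rintro ⟨L, ⟨hL, hpL⟩, M, ⟨hM, hpM⟩, h⟩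
    exact ⟨L, M, ⟨hL, hM, h⟩, (cross_eq_iff_incid h).2 ⟨hpL, hpM⟩⟩

theorem tm_eq_card {m : ℕ} (hm : 2 ≤ m) :
    tm A m = #{p ∈ multiplePoints A | linesThrough A p = m} := by
  rw [tm, ← Set.ncard_coe_finset]
  congr 1
  ext p
  simp only [Set.mem_ofPred_eq, coe_filter, mem_multiplePoints]
  omega

theorem linesThrough_ne_of_tm_eq_zero {m : ℕ} (hm : 2 ≤ m) (h : tm A m = 0) (p : ProjPlane k) :
    linesThrough A p ≠ m := by
  rintro rfl
  rw [tm_eq_card A hm, card_eq_zero] at h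
  exact notMem_empty p (h ▸ mem_filter.2 ⟨(mem_multiplePoints A).2 hm, rfl⟩)

theorem c2_eq_sum_multiplePoints :
    c2 A = 3 - 2 * (#A : ℤ) + ∑ p ∈ multiplePoints A, ((linesThrough A p : ℤ) - 1) := by
  rw [c2, ← sum_fiberwise_of_maps_to (t := Icc 2 #A) (g := linesThrough A)]
  · congr 1
    refine sum_congr rfl fun m hm ↦ ?_
    rw [tm_eq_card A (mem_Icc.1 hm).1, sum_congr rfl (g := fun _ ↦ (m : ℤ) - 1)]
    · rw [sum_const, nsmul_eq_mul, mul_comm]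
    · intro p hp
      rw [(mem_filter.1 hp).2]
  · exact fun p hp ↦ mem_Icc.2 ⟨(mem_multiplePoints A).1 hp, linesThrough_le_card A p⟩

theorem sum_multiplePoints_incid {L : ProjPlane k} (hL : L ∈ A) :
    ∑ p ∈ multiplePoints A, (if Incid p L then (linesThrough A p : ℤ) - 1 else 0) = #A - 1 := by
  have hmaps : ((A.erase L : Finset (ProjPlane k)) : Set (ProjPlane k)).MapsTo
      (Projectivization.cross L) (multiplePoints A) := by
    intro M hM
    obtain ⟨hne, hM⟩ := mem_erase.1 (mem_coe.1 hM)
    exact mem_coe.2 (mem_image.2 ⟨(L, M), mem_offDiag.2 ⟨hL, hM, hne.symm⟩, rfl⟩)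
  have hcard := card_eq_sum_card_fiberwise hmaps
  have hcard' : (#(A.erase L) : ℤ) = #A - 1 := by
    rw [card_erase_of_mem hL, Nat.cast_pred (card_pos.2 ⟨L, hL⟩)]
  rw [← hcard', hcard, Nat.cast_sum]
  refine sum_congr rfl fun p _ ↦ ?_
  split_ifs with hp
  · have hmem : L ∈ ({M ∈ A | Incid p M} : Finset _) := mem_filter.2 ⟨hL, hp⟩
    rw [linesThrough_eq_card, ← Nat.cast_pred (card_pos.2 ⟨L, hmem⟩), ← card_erase_of_mem hmem]
    congr 2
    ext M
    simp only [mem_erase, mem_filter]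
    constructor
    · rintro ⟨hne, hM, hpM⟩
      exact ⟨⟨hne, hM⟩, (cross_eq_iff_incid hne.symm).2 ⟨hp, hpM⟩⟩
    · rintro ⟨⟨hne, hM⟩, h⟩
      exact ⟨hne, hM, ((cross_eq_iff_incid hne.symm).1 h).2⟩
  · symm
    rw [Nat.cast_eq_zero, card_eq_zero, filter_eq_empty_iff]
    intro M hM h
    exact hp ((cross_eq_iff_incid (mem_erase.1 hM).1.symm).1 h).1

theorem card_mul_eq_sum_multiplePoints {T : Finset (ProjPlane k)} (hT : T ⊆ A) :
    (#T : ℤ) * (#A - 1) =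
      ∑ p ∈ multiplePoints A, (#{L ∈ T | Incid p L} : ℤ) * ((linesThrough A p : ℤ) - 1) := by
  rw [← nsmul_eq_mul, ← sum_const,
    sum_congr rfl fun L hL ↦ (sum_multiplePoints_incid A (hT hL)).symm, sum_comm]
  refine sum_congr rfl fun p _ ↦ ?_
  rw [← sum_filter, sum_const, nsmul_eq_mul]

theorem le_c2_of_forall_linesThrough_le_two (h : ∀ p, linesThrough A p ≤ 2) :
    (#A : ℤ) - 4 ≤ c2 A := by
  have hle : (#A : ℤ) * (#A - 1) ≤
      2 * ∑ p ∈ multiplePoints A, ((linesThrough A p : ℤ) - 1) := by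
    rw [card_mul_eq_sum_multiplePoints A subset_rfl, mul_sum]
    refine sum_le_sum fun p hp ↦ ?_
    rw [← linesThrough_eq_card]
    have := (mem_multiplePoints A).1 hp
    have := h p
    exact mul_le_mul_of_nonneg_right (by omega) (by omega)
  rw [c2_eq_sum_multiplePoints]
  nlinarith [sq_nonneg (2 * (#A : ℤ) - 7)]

/-- A point of multiplicity `m ≥ 2` bounds the second Chern number from below. -/
theorem mul_le_c2 {p : ProjPlane k} (hp : 2 ≤ linesThrough A p) :
    ((linesThrough A p : ℤ) - 2) * (#A - linesThrough A p - 1) ≤ c2 A := by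
  have hle : (linesThrough A p : ℤ) * (#A - 1) ≤
      ∑ q ∈ multiplePoints A, (((linesThrough A q : ℤ) - 1) +
        if q = p then ((linesThrough A p : ℤ) - 1) ^ 2 else 0) := by
    nth_rw 1 [linesThrough_eq_card A p]
    rw [card_mul_eq_sum_multiplePoints A (filter_subset _ _)]
    refine sum_le_sum fun q hq ↦ ?_
    split_ifs with h
    · subst h
      rw [filter_filter]
      simp only [and_self, ← linesThrough_eq_card]
      nlinarith
    · rw [add_zero]
      have hq := (mem_multiplePoints A).1 hq
      refine mul_le_of_le_one_left (by omega) ?_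
      norm_cast
      refine card_le_one.2 fun L hL M hM ↦ ?_
      simp only [mem_filter] at hL hM
      exact (hL.2.eq_or_eq hL.1.2 hM.2 hM.1.2).resolve_left h
  rw [sum_add_distrib, sum_ite_eq', if_pos ((mem_multiplePoints A).2 hp)] at hle
  rw [c2_eq_sum_multiplePoints]
  linarith

theorem card_sub_four_le_c2 (hA : 3 ≤ #A) (h1 : tm A #A = 0) (h2 : tm A (#A - 1) = 0) :
    (#A : ℤ) - 4 ≤ c2 A := by
  by_cases h : ∀ p, linesThrough A p ≤ 2
  · exact le_c2_of_forall_linesThrough_le_two A h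
  push Not at h
  obtain ⟨p, hp⟩ := h
  have hle := linesThrough_le_card A p
  have hne := linesThrough_ne_of_tm_eq_zero A (by omega) h1 p
  have hne' := linesThrough_ne_of_tm_eq_zero A (by omega) h2 p
  refine le_trans ?_ (mul_le_c2 A hp.le)
  have hlow : (0 : ℤ) ≤ linesThrough A p - 3 := by omega
  have hhigh : (0 : ℤ) ≤ #A - linesThrough A p - 2 := by omega
  linarith [mul_nonneg hlow hhigh]

end Counting

open Filter in
/-- If `A n` is a sequence of arrangements of `d n` lines with `d n → ∞`, each
neither trivial nor quasi-trivial (`t_{d n} = t_{d n - 1} = 0`), then `c̄₂(A n) → ∞`. -/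
theorem stmt_17 {k : Type*} [Field k] (A : ℕ → Finset (ProjPlane k))
    (hd : Tendsto (fun n => (A n).card) atTop atTop)
    (h1 : ∀ n, tm (A n) (A n).card = 0)
    (h2 : ∀ n, tm (A n) ((A n).card - 1) = 0) :
    Tendsto (fun n => c2 (A n)) atTop atTop := by
  refine tendsto_atTop_mono' atTop ?_
    (tendsto_atTop_add_const_right atTop (-4) (tendsto_natCast_atTop_atTop.comp hd))
  filter_upwards [hd.eventually_ge_atTop 3] with n hn
  exact card_sub_four_le_c2 (A n) hn (h1 n) (h2 n)
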